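/- arXiv:2504.09615 — 2 statements merged into one kernel-verified Lean document; each statement's English description precedes it below -/
import Mathlib

section
/- The linear maps 𝒯 and ℳ are mutually inverse: 𝒯 ∘ ℳ is the identity map on ℚ[X] and ℳ ∘ 𝒯 is the identity map on ℚ[X]. -/
open Polynomial

/-- The formula for `ℳ(Xⁿ) = ∑_{k=0}^{⌊n/2⌋} (−1)^k · C(n−k, k) · X^{n−k}`. -/
noncomputable def Mform (n : ℕ) : Polynomial ℚ :=
  ∑ k ∈ Finset.range (n / 2 + 1),
    Polynomial.C ((-1 : ℚ) ^ k * (Nat.choose (n - k) k : ℚ)) * Polynomial.X ^ (n - k)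

/-- The formula for `𝒯(Xⁿ) = ∑_{k=1}^{n} (k/(2n−k)) · C(2n−k, n−k) · X^k` (for `n ≥ 1`). -/
noncomputable def Tform (n : ℕ) : Polynomial ℚ :=
  ∑ k ∈ Finset.Icc 1 n,
    Polynomial.C ((k : ℚ) / ((2 * n - k : ℕ) : ℚ) * (Nat.choose (2 * n - k) (n - k) : ℚ)) *
      Polynomial.X ^ k

theorem coeff_Mform (n m : ℕ) :
    (Mform n).coeff m = if m ≤ n then (-1) ^ (n - m) * (Nat.choose m (n - m) : ℚ) else 0 := by
  have extend : Mform n = ∑ k ∈ Finset.range (n + 1),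
      C ((-1 : ℚ) ^ k * (Nat.choose (n - k) k : ℚ)) * X ^ (n - k) := by
    refine Finset.sum_subset (Finset.range_mono (by omega)) fun k hk hk' => ?_
    simp only [Finset.mem_range] at hk hk'
    simp [Nat.choose_eq_zero_of_lt (show n - k < k by omega)]
  rw [extend, finsetSum_coeff]
  simp only [coeff_C_mul_X_pow]
  split_ifs with h
  · rw [Finset.sum_eq_single (n - m)]
    · simp [Nat.sub_sub_self h]
    · intro k hk hne
      simp only [Finset.mem_range] at hk
      rw [if_neg (by omega)]
    · intro hk
      simp only [Finset.mem_range] at hk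
      omega
  · exact Finset.sum_eq_zero fun k _ => if_neg (by omega)

theorem Mform_zero : Mform 0 = 1 := by
  simp [Mform]

theorem Mform_one : Mform 1 = X := by
  simp [Mform]

theorem Mform_add_two (n : ℕ) : Mform (n + 2) = X * (Mform (n + 1) - Mform n) := by
  ext (_ | m)
  · simp [coeff_Mform]
  · rw [coeff_X_mul, coeff_sub]
    simp only [coeff_Mform]
    rcases lt_trichotomy m (n + 1) with h | rfl | h
    · obtain ⟨j, rfl⟩ := Nat.exists_eq_add_of_le (Nat.le_of_lt_succ h)
      rw [if_pos (by omega), if_pos (by omega), if_pos (by omega),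
        show m + j + 2 - (m + 1) = j + 1 by omega, show m + j + 1 - m = j + 1 by omega,
        show m + j - m = j by omega, Nat.choose_succ_succ]
      push_cast
      ring
    · simp
    · rw [if_neg (by omega), if_neg (by omega), if_neg (by omega), sub_zero]

theorem coeff_Tform (n m : ℕ) :
    (Tform n).coeff m = if m ≤ n then
      (m : ℚ) / ((2 * n - m : ℕ) : ℚ) * (Nat.choose (2 * n - m) (n - m) : ℚ) else 0 := by
  rw [Tform, finsetSum_coeff]
  simp only [coeff_C_mul_X_pow, Finset.sum_ite_eq, Finset.mem_Icc]
  rcases Nat.eq_zero_or_pos m with rfl | h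
  · simp
  · simp [Nat.one_le_iff_ne_zero, h.ne']

theorem coeff_Tform_add (k j : ℕ) :
    (Tform (k + j)).coeff k = (k : ℚ) / (k + 2 * j) * (Nat.choose (k + 2 * j) j : ℚ) := by
  rw [coeff_Tform, if_pos (by omega), show 2 * (k + j) - k = k + 2 * j by omega,
    Nat.add_sub_cancel_left]
  push_cast
  rfl

/-- The recurrence of the ballot numbers. -/
theorem coeff_Tform_succ (n k : ℕ) (hn : 1 ≤ n) :
    (Tform (n + 1)).coeff (k + 1) = (Tform (n + 1)).coeff (k + 2) + (Tform n).coeff k := by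
  rcases lt_trichotomy k n with h | rfl | h
  · obtain ⟨i, rfl⟩ := Nat.exists_eq_add_of_lt h
    have h₁ := coeff_Tform_add (k + 1) (i + 1)
    have h₂ := coeff_Tform_add (k + 2) i
    have h₃ := coeff_Tform_add k (i + 1)
    rw [show k + 1 + (i + 1) = k + i + 1 + 1 by ring,
      show k + 1 + 2 * (i + 1) = k + 2 * i + 2 + 1 by ring] at h₁
    rw [show k + 2 + i = k + i + 1 + 1 by ring,
      show k + 2 + 2 * i = k + 2 * i + 2 by ring] at h₂
    rw [← add_assoc, show k + 2 * (i + 1) = k + 2 * i + 2 by ring] at h₃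
    rw [h₁, h₂, h₃, Nat.choose_succ_succ]
    have ratio : (Nat.choose (k + 2 * i + 2) (i + 1) : ℚ) =
        Nat.choose (k + 2 * i + 2) i * (k + i + 2) / (i + 1) := by
      rw [eq_div_iff (by positivity)]
      have := Nat.choose_succ_right_eq (k + 2 * i + 2) i
      rw [show k + 2 * i + 2 - i = k + i + 2 by omega] at this
      exact_mod_cast this
    push_cast
    rw [ratio]
    field_simp
    ring
  · have : (k : ℚ) ≠ 0 := by positivity
    have : (k : ℚ) + 1 ≠ 0 := by positivity
    have h₁ := coeff_Tform_add (k + 1) 0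
    have h₃ := coeff_Tform_add k 0
    simp_all [coeff_Tform (k + 1) (k + 2)]
  · simp only [coeff_Tform]
    rw [if_neg (by omega), if_neg (by omega), if_neg (by omega), add_zero]

theorem X_sub_one_mul_Tform_succ (n : ℕ) (hn : 1 ≤ n) :
    (X - 1) * Tform (n + 1) = X ^ 2 * Tform n - C ((Tform n).eval 1) * X := by
  have key : (X - 1) * Tform (n + 1) = X ^ 2 * Tform n - C ((Tform (n + 1)).coeff 1) * X := by
    ext (_ | _ | m)
    · simp [sub_mul, coeff_Tform]
    · simp [sub_mul, coeff_X_mul, coeff_Tform (n + 1) 0, coeff_X_pow_mul']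
    · rw [sub_mul, one_mul, coeff_sub, coeff_X_mul, coeff_sub, coeff_X_pow_mul, coeff_C_mul,
        coeff_X_of_ne_one (by omega), coeff_Tform_succ n m hn]
      ring
  have h := congrArg (eval 1) key
  simp only [eval_mul, eval_sub, eval_X, eval_one, eval_pow, eval_C, sub_self, zero_mul, one_pow,
    one_mul, mul_one] at h
  rw [key, sub_eq_zero.mp h.symm]

/-- The linear maps `𝒯` and `ℳ` are mutually inverse. -/
theorem T_M_inverse (M T : Polynomial ℚ →ₗ[ℚ] Polynomial ℚ)
    (hM : ∀ n : ℕ, M (Polynomial.X ^ n) = Mform n)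
    (hT1 : T 1 = 1)
    (hTn : ∀ n : ℕ, 1 ≤ n → T (Polynomial.X ^ n) = Tform n) :
    (∀ p : Polynomial ℚ, T (M p) = p) ∧ (∀ p : Polynomial ℚ, M (T p) = p) := by
  have hT : ∀ q, (X - 1) * T (X * q) = X ^ 2 * T q - C ((T q).eval 1) * X := by
    intro q
    induction q using Polynomial.induction_on' with
    | add p q hp hq =>
      rw [mul_add, map_add, map_add, eval_add, C_add, mul_add, hp, hq]
      ring
    | monomial n a =>
      have base : (X - 1) * T (X ^ (n + 1)) =
          X ^ 2 * T (X ^ n) - C ((T (X ^ n)).eval 1) * X := by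
        rcases Nat.eq_zero_or_pos n with rfl | hn
        · rw [hTn _ le_rfl, pow_zero, hT1]
          simp [Tform]
          ring
        · rw [hTn _ (by omega), hTn n hn, X_sub_one_mul_Tform_succ n hn]
      rw [← smul_X_eq_monomial, mul_smul_comm, ← pow_succ', map_smul, map_smul, mul_smul_comm,
        base, eval_smul, smul_eq_mul, C_mul, smul_eq_C_mul, smul_eq_C_mul]
      ring
  have hMX : ∀ q, M (X ^ 2 * q) = X * M ((X - 1) * q) := by
    intro q
    induction q using Polynomial.induction_on' with
    | add p q hp hq => rw [mul_add, map_add, hp, hq, mul_add, map_add, mul_add]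
    | monomial n a =>
      rw [← smul_X_eq_monomial, mul_smul_comm, mul_smul_comm, map_smul, map_smul, mul_smul_comm,
        ← pow_add, add_comm 2 n, sub_mul, ← pow_succ', one_mul, map_sub, hM, hM, hM,
        Mform_add_two]
  have hM1 : M 1 = 1 := by rw [← pow_zero X, hM, Mform_zero, pow_zero]
  have hMX1 : M X = X := by simpa [Mform_one] using hM 1
  have hTX : T X = X := by simpa [Tform] using hTn 1 le_rfl
  have hX : (X - 1 : ℚ[X]) ≠ 0 := X_sub_C_ne_zero (1 : ℚ)
  have TM : ∀ n, T (M (X ^ n)) = X ^ n := by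
    intro n
    induction n using Nat.twoStepInduction with
    | zero => rw [pow_zero, hM1, hT1]
    | one => rw [pow_one, hMX1, hTX]
    | more n h₀ h₁ =>
      apply mul_left_cancel₀ hX
      rw [hM, Mform_add_two, ← hM, ← hM, hT, map_sub, h₀, h₁]
      simp
      ring
  have MT : ∀ n, M (T (X ^ n)) = X ^ n := by
    intro n
    induction n with
    | zero => rw [pow_zero, hT1, hM1]
    | succ n ih =>
      obtain ⟨q, hq⟩ := X_sub_C_dvd_sub_C_eval (p := T (X ^ n)) (a := 1)
      rw [C_1] at hq
      have hq' : T (X ^ n) = (X - 1) * q + (T (X ^ n)).eval 1 • 1 := by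
        rw [smul_eq_C_mul, mul_one, ← hq, sub_add_cancel]
      have step : T (X ^ (n + 1)) = X ^ 2 * q + (T (X ^ n)).eval 1 • X := by
        apply mul_left_cancel₀ hX
        rw [pow_succ', hT, smul_eq_C_mul]
        linear_combination X ^ 2 * hq
      have ih' : M ((X - 1) * q) + (T (X ^ n)).eval 1 • M 1 = X ^ n := by
        rw [← map_smul, ← map_add, ← hq', ih]
      rw [hM1, smul_eq_C_mul] at ih'
      rw [step, map_add, map_smul, hMX, hMX1, pow_succ', smul_eq_C_mul]
      linear_combination X * ih'
  constructor
  · intro p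
    have : T ∘ₗ M = LinearMap.id := lhom_ext' fun n => LinearMap.ext_ring (by
      simpa [← X_pow_eq_monomial] using TM n)
    exact LinearMap.congr_fun this p
  · intro p
    have : M ∘ₗ T = LinearMap.id := lhom_ext' fun n => LinearMap.ext_ring (by
      simpa [← X_pow_eq_monomial] using MT n)
    exact LinearMap.congr_fun this p
end

section
/- Let t ∈ ℚ[X] be any polynomial and let m = ℳ(t). Then m evaluated at 4 equals t evaluated at 2 plus twice the derivative of t evaluated at 2: m(4) = t(2) + 2·t′(2). -/
open Polynomial

theorem Mform_eq_sum_antidiagonal (n : ℕ) :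
    Mform n = ∑ p ∈ Finset.HasAntidiagonal.antidiagonal n,
      C ((-1 : ℚ) ^ p.2 * (p.1.choose p.2 : ℚ)) * X ^ p.1 := by
  rw [← Finset.Nat.sum_antidiagonal_swap, Finset.Nat.sum_antidiagonal_eq_sum_range_succ_mk]
  refine Finset.sum_subset (Finset.range_mono (by omega)) fun k _ hk => ?_
  rw [Finset.mem_range] at hk
  simp [Nat.choose_eq_zero_of_lt (show n - k < k by grind)]

theorem Mform_eval_four (n : ℕ) : (Mform n).eval 4 = (n + 1) * 2 ^ n := by
  induction n using Nat.twoStepInduction with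
  | zero => simp [Mform]
  | one => norm_num [Mform]
  | more n h₀ h₁ =>
    rw [Mform_add_two, eval_mul, eval_sub, h₀, h₁, eval_X]
    push_cast
    ring

/-- For `m = ℳ(t)`, one has `m(4) = t(2) + 2·t′(2)`. -/
theorem M_eval_four (M : Polynomial ℚ →ₗ[ℚ] Polynomial ℚ)
    (hM : ∀ n : ℕ, M (Polynomial.X ^ n) = Mform n)
    (t : Polynomial ℚ) :
    (M t).eval 4 = t.eval 2 + 2 * (Polynomial.derivative t).eval 2 := by
  induction t using Polynomial.induction_on' with
  | add p q hp hq =>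
    simp only [map_add, eval_add, hp, hq]
    ring
  | monomial n a =>
    rw [← mul_one a, ← smul_eq_mul, ← smul_monomial, monomial_one_right_eq_X_pow, map_smul, hM,
      eval_smul, Mform_eval_four, derivative_smul, derivative_X_pow]
    cases n with
    | zero => simp
    | succ n =>
      simp
      ring
end
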